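/- arXiv:1201.0419 — 4 statements merged into one kernel-verified Lean document; each statement's English description precedes it below -/
import Mathlib

section
/- Let C be an abelian category with a monoidal structure whose tensor product is additive in each variable. Assume that (a) C has enough projective objects and enough injective objects, (b) every projective object of C is injective and every injective object is projective, and (c) every projective object of C is rigid. If 0 → L → M → N → 0 is a short exact sequence in C such that two of the three objects L, M, N are rigid, then the third object is also rigid. -/
open CategoryTheory CategoryTheory.MonoidalCategory

/-- An object is rigid if it has both a left dual and a right dual. -/
def IsRigid {C : Type*} [Category C] [MonoidalCategory C] (X : C) : Prop :=
  Nonempty (HasLeftDual X) ∧ Nonempty (HasRightDual X)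

open Opposite Limits

section Opposite

variable {C : Type*} [Category C] [MonoidalCategory C]

/-- An exact pairing in `C` is an exact pairing in the opposite category, with the roles of the
two objects exchanged. -/
@[reducible]
def CategoryTheory.ExactPairing.op (X Y : C) [ExactPairing X Y] : ExactPairing (op Y) (op X) where
  coevaluation' := (ε_ X Y).op
  evaluation' := (η_ X Y).op
  coevaluation_evaluation' := Quiver.Hom.unop_inj (by simp)
  evaluation_coevaluation' := Quiver.Hom.unop_inj (by simp)

/-- An exact pairing in the opposite category is an exact pairing in `C`, with the roles of the
two objects exchanged. -/
@[reducible]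
def CategoryTheory.ExactPairing.unop (X Y : Cᵒᵖ) [ExactPairing X Y] :
    ExactPairing (unop Y) (unop X) where
  coevaluation' := (ε_ X Y).unop
  evaluation' := (η_ X Y).unop
  coevaluation_evaluation' := Quiver.Hom.op_inj (by simp)
  evaluation_coevaluation' := Quiver.Hom.op_inj (by simp)

theorem IsRigid.op {X : C} (hX : IsRigid X) : IsRigid (op X) := by
  obtain ⟨⟨hl⟩, ⟨hr⟩⟩ := hX
  let := ExactPairing.op (ᘁX) X
  let := ExactPairing.op X (Xᘁ)
  exact ⟨⟨⟨Opposite.op (Xᘁ)⟩⟩, ⟨⟨Opposite.op (ᘁX)⟩⟩⟩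

instance [Preadditive C] [MonoidalPreadditive C] : MonoidalPreadditive Cᵒᵖ where
  whiskerLeft_zero := Quiver.Hom.unop_inj (by simp)
  zero_whiskerRight := Quiver.Hom.unop_inj (by simp)
  whiskerLeft_add _ _ := Quiver.Hom.unop_inj (by simp)
  add_whiskerRight _ _ := Quiver.Hom.unop_inj (by simp)

end Opposite

/-- An abelian monoidal category with enough projective and injective objects, in which the
projective objects coincide with the injective objects, and all of them are rigid. -/
class RigidFrobenius (C : Type*) [Category C] [Abelian C] [MonoidalCategory C] : Prop where
  enoughProjectives : EnoughProjectives C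
  enoughInjectives : EnoughInjectives C
  injective_of_projective (P : C) : Projective P → Injective P
  projective_of_injective (I : C) : Injective I → Projective I
  isRigid_of_projective (P : C) : Projective P → IsRigid P

attribute [instance] RigidFrobenius.enoughProjectives RigidFrobenius.enoughInjectives

/-- Tensoring with `X` on either side preserves projective objects. -/
def TensorProjective {C : Type*} [Category C] [MonoidalCategory C] (X : C) : Prop :=
  ∀ P : C, Projective P → Projective (P ⊗ X) ∧ Projective (X ⊗ P)

section

variable {C : Type*} [Category C] [MonoidalCategory C] {P X D U : C} [ExactPairing U (P ⊗ X)]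

/-- Given an exact pairing of `U` and `P ⊗ X`, an object `D` mapping to `U` is left dual to `X` if
the evaluation and coevaluation are compatible with those of the given pairing through
`p : P ⟶ 𝟙_ C` and `k : D ⟶ U`, provided that `p` and `k` can be cancelled. -/
@[reducible]
def exactPairingOfEpiMono (p : P ⟶ 𝟙_ C) (k : D ⟶ U) [Epi (p ▷ (X ⊗ 𝟙_ C))] [Mono (k ▷ 𝟙_ C)]
    (ev : X ⊗ D ⟶ 𝟙_ C) (co : 𝟙_ C ⟶ D ⊗ X)
    (hev : p ▷ (X ⊗ D) ≫ (λ_ (X ⊗ D)).hom ≫ ev = (α_ P X D).inv ≫ (P ⊗ X) ◁ k ≫ ε_ U (P ⊗ X))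
    (hco : co ≫ k ▷ X = η_ U (P ⊗ X) ≫ U ◁ (p ▷ X ≫ (λ_ X).hom)) : ExactPairing D X where
  coevaluation' := co
  evaluation' := ev
  coevaluation_evaluation' := by
    rw [← cancel_epi (p ▷ (X ⊗ 𝟙_ C) ≫ (λ_ (X ⊗ 𝟙_ C)).hom)]
    calc
      _ = (p ▷ (X ⊗ 𝟙_ C) ≫ 𝟙_ C ◁ X ◁ co) ≫ (λ_ _).hom ≫ (α_ X D X).inv ≫ ev ▷ X := by
        simp
      _ = P ◁ X ◁ co ≫ P ◁ (α_ X D X).inv ≫ (α_ _ _ _).inv ≫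
          (p ▷ (X ⊗ D) ≫ (λ_ (X ⊗ D)).hom ≫ ev) ▷ X := by
        rw [← whisker_exchange]
        monoidal
      _ = (α_ _ _ _).inv ≫ (P ⊗ X) ◁ (co ≫ k ▷ X) ≫ (α_ _ _ _).inv ≫ ε_ U (P ⊗ X) ▷ X := by
        rw [hev]
        monoidal
      _ = (α_ _ _ _).inv ≫ ((P ⊗ X) ◁ η_ U (P ⊗ X) ≫ (α_ _ _ _).inv ≫
          ε_ U (P ⊗ X) ▷ (P ⊗ X)) ≫ 𝟙_ C ◁ (p ▷ X ≫ (λ_ X).hom) := by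
        rw [hco, Category.assoc, Category.assoc, ← whisker_exchange]
        monoidal
      _ = _ := by
        rw [ExactPairing.coevaluation_evaluation]
        monoidal
  evaluation_coevaluation' := by
    rw [← cancel_mono (k ▷ 𝟙_ C)]
    calc
      _ = co ▷ D ≫ (α_ _ _ _).hom ≫ D ◁ ev ≫ k ▷ 𝟙_ C := by simp
      _ = (co ≫ k ▷ X) ▷ D ≫ (α_ _ _ _).hom ≫ U ◁ ev := by
        rw [whisker_exchange]
        simp
      _ = η_ U (P ⊗ X) ▷ D ≫ (α_ _ _ _).hom ≫
          U ◁ ((α_ _ _ _).hom ≫ p ▷ (X ⊗ D) ≫ (λ_ (X ⊗ D)).hom ≫ ev) := by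
        rw [hco]
        monoidal
      _ = (η_ U (P ⊗ X) ▷ D ≫ (U ⊗ (P ⊗ X)) ◁ k) ≫ (α_ _ _ _).hom ≫ U ◁ ε_ U (P ⊗ X) := by
        rw [hev]
        monoidal
      _ = 𝟙_ C ◁ k ≫ η_ U (P ⊗ X) ▷ U ≫ (α_ _ _ _).hom ≫ U ◁ ε_ U (P ⊗ X) := by
        rw [← whisker_exchange, Category.assoc]
      _ = _ := by
        rw [ExactPairing.evaluation_coevaluation]
        monoidal

end

namespace IsRigid

variable {C : Type*} [Category C] [MonoidalCategory C] {X : C}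

theorem preservesLimits_tensorLeft (hX : IsRigid X) : PreservesLimits (tensorLeft X) :=
  let ⟨_, ⟨_⟩⟩ := hX
  (tensorLeftAdjunction X (Xᘁ)).rightAdjoint_preservesLimits

theorem preservesColimits_tensorLeft (hX : IsRigid X) : PreservesColimits (tensorLeft X) :=
  let ⟨⟨_⟩, _⟩ := hX
  (tensorLeftAdjunction (ᘁX) X).leftAdjoint_preservesColimits

theorem preservesLimits_tensorRight (hX : IsRigid X) : PreservesLimits (tensorRight X) :=
  let ⟨⟨_⟩, _⟩ := hX
  (tensorRightAdjunction (ᘁX) X).rightAdjoint_preservesLimits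

theorem preservesColimits_tensorRight (hX : IsRigid X) : PreservesColimits (tensorRight X) :=
  let ⟨_, ⟨_⟩⟩ := hX
  (tensorRightAdjunction X (Xᘁ)).leftAdjoint_preservesColimits

theorem projective_rightDual_tensor {X Q : C} (hX : IsRigid X) (hQ : Projective Q)
    (Y : C) [ExactPairing X Y] : Projective (Y ⊗ Q) :=
  have := hX.preservesColimits_tensorLeft
  (tensorLeftAdjunction X Y).map_projective Q hQ

end IsRigid

namespace RigidFrobenius

variable {C : Type*} [Category C] [Abelian C] [MonoidalCategory C] [RigidFrobenius C]

theorem projective_iff_injective {P : C} : Projective P ↔ Injective P :=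
  ⟨injective_of_projective P, projective_of_injective P⟩

instance : RigidFrobenius Cᵒᵖ where
  enoughProjectives := inferInstance
  enoughInjectives := inferInstance
  injective_of_projective P _ :=
    Injective.projective_iff_injective_op.1 <|
      projective_of_injective _ (inferInstanceAs (Injective P.unop))
  projective_of_injective I _ :=
    Injective.injective_iff_projective_op.1 <|
      injective_of_projective _ (inferInstanceAs (Projective I.unop))
  isRigid_of_projective P _ :=
    (isRigid_of_projective _ (projective_of_injective _ (inferInstanceAs (Injective P.unop)))).op

theorem projective_tensor_rightDual {X Q : C} (hX : IsRigid X) (hQ : Projective Q)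
    (Y : C) [ExactPairing X Y] : Projective (Q ⊗ Y) :=
  have := hX.preservesLimits_tensorRight
  projective_of_injective _ <|
    (tensorRightAdjunction X Y).map_injective Q (injective_of_projective Q hQ)

theorem projective_rightDual {P : C} (hP : Projective P) (Y : C) [ExactPairing P Y] :
    Projective Y := by
  have hr := isRigid_of_projective P hP
  have := hr.projective_rightDual_tensor (projective_tensor_rightDual hr hP Y) Y
  exact Retract.projective (Y := Y ⊗ P ⊗ Y)
    { i := (ρ_ Y).inv ≫ Y ◁ η_ P Y
      r := (α_ Y P Y).inv ≫ ε_ P Y ▷ Y ≫ (λ_ Y).hom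
      retract := by simp }

theorem projective_leftDual {P : C} (hP : Projective P) (Z : C) [ExactPairing Z P] :
    Projective Z := by
  let := ExactPairing.op Z P
  have := injective_of_projective P hP
  have := projective_rightDual (P := op P) inferInstance (op Z)
  exact projective_of_injective Z (inferInstanceAs (Injective (op Z).unop))

theorem _root_.IsRigid.tensorProjective {X : C} (hX : IsRigid X) : TensorProjective X := by
  intro P hP
  obtain ⟨-, ⟨_⟩⟩ := isRigid_of_projective P hP
  obtain ⟨-, ⟨_⟩⟩ := id hX
  have hR := projective_rightDual hP (Pᘁ)
  exact ⟨projective_leftDual (hX.projective_rightDual_tensor hR (Xᘁ)) (P ⊗ X),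
    projective_leftDual (projective_tensor_rightDual hX hR (Xᘁ)) (X ⊗ P)⟩

theorem _root_.TensorProjective.op {X : C} (hX : TensorProjective X) :
    TensorProjective (Opposite.op X) := by
  intro P hP
  have := hX P.unop (projective_of_injective _ (inferInstanceAs (Injective P.unop)))
  simp only [projective_iff_injective] at this
  exact ⟨Injective.injective_iff_projective_op.1 this.1,
    Injective.injective_iff_projective_op.1 this.2⟩

theorem projective_two_out_of_three {S : ShortComplex C} (hS : S.ShortExact)
    (h : (Projective S.X₁ ∧ Projective S.X₂) ∨ (Projective S.X₁ ∧ Projective S.X₃) ∨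
      (Projective S.X₂ ∧ Projective S.X₃)) :
    Projective S.X₁ ∧ Projective S.X₂ ∧ Projective S.X₃ := by
  obtain ⟨s⟩ : Nonempty S.Splitting := by
    have h' : Projective S.X₁ ∨ Projective S.X₃ := by tauto
    obtain h' | h' := h'
    · have := injective_of_projective _ h'
      exact ⟨hS.splittingOfInjective⟩
    · exact ⟨hS.splittingOfProjective⟩
  have h₁ (_ : Projective S.X₂) : Projective S.X₁ :=
    Retract.projective (Y := S.X₂) { i := S.f, r := s.r, retract := s.f_r }
  have h₃ (_ : Projective S.X₂) : Projective S.X₃ :=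
    Retract.projective (Y := S.X₂) { i := s.s, r := S.g, retract := s.s_g }
  have h₂ (_ : Projective S.X₁) (_ : Projective S.X₃) : Projective S.X₂ :=
    Projective.of_iso s.isoBinaryBiproduct.symm inferInstance
  tauto

variable [MonoidalPreadditive C]

variable (C) in
/-- The tensor unit has a projective presentation which remains right exact after tensoring on the
right with an arbitrary object. -/
theorem exists_whiskerRight_presentation :
    ∃ (P Q : C) (f : Q ⟶ P) (p : P ⟶ 𝟙_ C), Projective P ∧ Projective Q ∧ f ≫ p = 0 ∧
      ∀ X : C, Epi (p ▷ X) ∧ ∀ (Z : C) (g : P ⊗ X ⟶ Z), f ▷ X ≫ g = 0 →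
        ∃ h : X ⟶ Z, p ▷ X ≫ (λ_ X).hom ≫ h = g := by
  let P := Projective.over (𝟙_ C)
  let p : P ⟶ 𝟙_ C := Projective.π (𝟙_ C)
  have := (isRigid_of_projective P inferInstance).preservesColimits_tensorLeft
  have hq (X : C) : Epi (P ◁ Projective.π X) :=
    inferInstanceAs (Epi ((tensorLeft _).map (Projective.π X)))
  have hepi (X : C) : Epi (p ▷ X) := by
    have := (isRigid_of_projective (Projective.over X) inferInstance).preservesColimits_tensorRight
    have : Epi (p ▷ Projective.over X) := inferInstanceAs (Epi ((tensorRight _).map p))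
    have : Epi (P ◁ Projective.π X ≫ p ▷ X) := by
      rw [whisker_exchange, id_whiskerLeft]
      infer_instance
    exact epi_of_epi (P ◁ Projective.π X) _
  have hdp : Projective.d p ≫ p = 0 :=
    (Category.assoc _ _ _).trans ((_ ≫= kernel.condition p).trans comp_zero)
  refine ⟨P, _, Projective.d p, p, inferInstance, inferInstance, hdp,
    fun X => ⟨hepi X, fun Z g hg => ?_⟩⟩
  let R := Projective.over X
  let q : R ⟶ X := Projective.π X
  have : Epi (P ◁ q) := hq X
  have := (isRigid_of_projective R inferInstance).preservesColimits_tensorRight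
  obtain ⟨h, hh⟩ : ∃ h : 𝟙_ C ⊗ R ⟶ Z, p ▷ R ≫ h = P ◁ q ≫ g := by
    have : Epi ((ShortComplex.mk _ _ hdp).map (tensorRight R)).g :=
      inferInstanceAs (Epi ((tensorRight R).map p))
    exact ((exact_d_f p).map_of_epi_of_preservesCokernel (tensorRight R)
      inferInstance inferInstance).desc' (P ◁ q ≫ g) (by
        change Projective.d p ▷ R ≫ P ◁ q ≫ g = 0
        rw [← whisker_exchange_assoc, hg, comp_zero])
  obtain ⟨h', hh'⟩ : ∃ h' : X ⟶ Z, q ≫ h' = (λ_ R).inv ≫ h := by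
    refine (ShortComplex.exact_kernel q).desc' ((λ_ R).inv ≫ h) ?_
    have := hepi (kernel q)
    rw [← cancel_epi (λ_ _).hom, ← cancel_epi (p ▷ kernel q)]
    have : (λ_ _).hom ≫ kernel.ι q ≫ (λ_ _).inv = 𝟙_ C ◁ kernel.ι q := by simp
    dsimp
    rw [reassoc_of% this, ← whisker_exchange_assoc, hh, ← whiskerLeft_comp_assoc]
    simp
  refine ⟨h', ?_⟩
  rw [← cancel_epi (P ◁ q), ← hh, whisker_exchange_assoc]
  simp [hh']

variable (C) in
/-- The tensor unit has an injective copresentation which remains left exact after tensoring on the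
left with an arbitrary object. -/
theorem exists_whiskerLeft_copresentation :
    ∃ (I J : C) (i : 𝟙_ C ⟶ I) (f : I ⟶ J), Projective I ∧ Projective J ∧ i ≫ f = 0 ∧
      ∀ X : C, Mono (X ◁ i) ∧ ∀ (Z : C) (g : Z ⟶ X ⊗ I), g ≫ X ◁ f = 0 →
        ∃ h : Z ⟶ X, h ≫ (ρ_ X).inv ≫ X ◁ i = g := by
  let I := Injective.under (𝟙_ C)
  let i : 𝟙_ C ⟶ I := Injective.ι (𝟙_ C)
  have hI : Projective I := projective_of_injective I inferInstance
  have := (isRigid_of_projective I inferInstance).preservesLimits_tensorRight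
  have hR (X : C) := isRigid_of_projective (Injective.under X)
    (projective_of_injective _ inferInstance)
  have hq (X : C) : Mono (Injective.ι X ▷ I) :=
    inferInstanceAs (Mono ((tensorRight _).map (Injective.ι X)))
  have hmono (X : C) : Mono (X ◁ i) := by
    have := (hR X).preservesLimits_tensorLeft
    have : Mono (Injective.under X ◁ i) := inferInstanceAs (Mono ((tensorLeft _).map i))
    have : Mono (X ◁ i ≫ Injective.ι X ▷ I) := by
      rw [whisker_exchange, whiskerRight_id]
      infer_instance
    exact mono_of_mono _ (Injective.ι X ▷ I)
  have hid : i ≫ Injective.d i = 0 :=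
    (Category.assoc _ _ _).symm.trans ((cokernel.condition i =≫ _).trans zero_comp)
  refine ⟨I, _, i, Injective.d i, inferInstance, projective_of_injective _ inferInstance,
    hid, fun X => ⟨hmono X, fun Z g hg => ?_⟩⟩
  let R := Injective.under X
  let q : X ⟶ R := Injective.ι X
  have : Mono (q ▷ I) := hq X
  have := (hR X).preservesLimits_tensorLeft
  obtain ⟨h, hh⟩ : ∃ h : Z ⟶ R ⊗ 𝟙_ C, h ≫ R ◁ i = g ≫ q ▷ I := by
    have : Mono ((ShortComplex.mk _ _ hid).map (tensorLeft R)).f :=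
      inferInstanceAs (Mono ((tensorLeft R).map i))
    exact ((exact_f_d i).map_of_mono_of_preservesKernel (tensorLeft R)
      inferInstance inferInstance).lift' (g ≫ q ▷ I) (by
        change (g ≫ q ▷ I) ≫ R ◁ Injective.d i = 0
        rw [Category.assoc, ← whisker_exchange, reassoc_of% hg, zero_comp])
  obtain ⟨h', hh'⟩ : ∃ h' : Z ⟶ X, h' ≫ q = h ≫ (ρ_ R).hom := by
    refine (ShortComplex.exact_cokernel q).lift' (h ≫ (ρ_ R).hom) ?_
    have := hmono (cokernel q)
    rw [← cancel_mono (ρ_ _).inv, ← cancel_mono (cokernel q ◁ i)]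
    have : (ρ_ _).hom ≫ cokernel.π q ≫ (ρ_ _).inv = cokernel.π q ▷ 𝟙_ C := by simp
    dsimp
    simp only [Category.assoc]
    rw [reassoc_of% this, ← whisker_exchange, reassoc_of% hh, ← comp_whiskerRight]
    simp
  refine ⟨h', ?_⟩
  rw [← cancel_mono (q ▷ I), ← hh, Category.assoc, Category.assoc, whisker_exchange]
  simp [reassoc_of% hh']

theorem exists_lift_kernel_whiskerRight {X : C} (hX : TensorProjective X) {U V T : C} (f : U ⟶ V)
    (u : T ⟶ U ⊗ X) (hu : u ≫ f ▷ X = 0) : ∃ t : T ⟶ kernel f ⊗ X, t ≫ kernel.ι f ▷ X = u := by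
  obtain ⟨I, J, i, e, hI, hJ, hie, H⟩ := exists_whiskerLeft_copresentation C
  have := (isRigid_of_projective _ (hX I hI).2).preservesLimits_tensorRight
  have := (isRigid_of_projective _ (hX J hJ).2).preservesLimits_tensorRight
  have : Mono (kernel.ι f ▷ (X ⊗ I)) := inferInstanceAs (Mono ((tensorRight _).map (kernel.ι f)))
  have : Mono (kernel.ι f ▷ (X ⊗ J)) := inferInstanceAs (Mono ((tensorRight _).map (kernel.ι f)))
  obtain ⟨w, hw⟩ : ∃ w : T ⟶ kernel f ⊗ (X ⊗ I),
      w ≫ kernel.ι f ▷ (X ⊗ I) = u ≫ (ρ_ _).inv ≫ (U ⊗ X) ◁ i ≫ (α_ _ _ _).hom := by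
    have : Mono ((ShortComplex.mk _ _ (kernel.condition f)).map (tensorRight (X ⊗ I))).f :=
      inferInstanceAs (Mono (kernel.ι f ▷ (X ⊗ I)))
    refine ((ShortComplex.exact_kernel f).map_of_mono_of_preservesKernel (tensorRight (X ⊗ I))
      inferInstance inferInstance).lift' _ ?_
    have : (ρ_ _).inv ≫ (U ⊗ X) ◁ i ≫ (α_ _ _ _).hom ≫ f ▷ (X ⊗ I) =
        f ▷ X ≫ (ρ_ _).inv ≫ (V ⊗ X) ◁ i ≫ (α_ _ _ _).hom := by
      rw [← associator_naturality_left, whisker_exchange_assoc, rightUnitor_inv_naturality_assoc]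
    change _ ≫ f ▷ (X ⊗ I) = 0
    simp only [Category.assoc, this, reassoc_of% hu, zero_comp]
  obtain ⟨t, ht⟩ := (H (kernel f ⊗ X)).2 T (w ≫ (α_ _ _ _).inv) (by
    rw [← cancel_mono (α_ _ _ _).hom, ← cancel_mono (kernel.ι f ▷ (X ⊗ J))]
    have : w ≫ (α_ _ _ _).inv ≫ (kernel f ⊗ X) ◁ e ≫ (α_ _ _ _).hom ≫ kernel.ι f ▷ (X ⊗ J) =
        (w ≫ kernel.ι f ▷ (X ⊗ I)) ≫ U ◁ X ◁ e := by
      rw [associator_naturality_right_assoc, whisker_exchange]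
      simp
    simp only [Category.assoc, this, hw, zero_comp]
    rw [← associator_naturality_right, ← whiskerLeft_comp_assoc, hie]
    simp)
  refine ⟨t, ?_⟩
  have := (H (U ⊗ X)).1
  rw [← cancel_mono (ρ_ _).inv, ← cancel_mono ((U ⊗ X) ◁ i), ← cancel_mono (α_ _ _ _).hom]
  simp only [Category.assoc]
  rw [← hw, rightUnitor_inv_naturality_assoc, ← whisker_exchange_assoc, reassoc_of% ht]
  simp

theorem _root_.TensorProjective.nonempty_hasLeftDual {X : C} (hX : TensorProjective X) :
    Nonempty (HasLeftDual X) := by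
  obtain ⟨P, Q, f, p, hP, hQ, hfp, H⟩ := exists_whiskerRight_presentation C
  obtain ⟨⟨_⟩, -⟩ := isRigid_of_projective _ (hX P hP).1
  obtain ⟨⟨_⟩, -⟩ := isRigid_of_projective _ (hX Q hQ).1
  let U : C := ᘁ(P ⊗ X)
  let f' : U ⟶ (ᘁ(Q ⊗ X) : C) := ᘁ(f ▷ X)
  let k := kernel.ι f'
  obtain ⟨ev, hev⟩ := (H (X ⊗ kernel f')).2 (𝟙_ C)
    ((α_ _ _ _).inv ≫ (P ⊗ X) ◁ k ≫ ε_ U (P ⊗ X)) (by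
      have h : (f ▷ X) ▷ U ≫ ε_ U (P ⊗ X) = (Q ⊗ X) ◁ f' ≫ ε_ (ᘁ(Q ⊗ X) : C) (Q ⊗ X) :=
        (leftAdjointMate_comp_evaluation (f ▷ X)).symm
      rw [associator_inv_naturality_left_assoc, ← whisker_exchange_assoc, h,
        ← whiskerLeft_comp_assoc, kernel.condition]
      simp)
  obtain ⟨co, hco⟩ := exists_lift_kernel_whiskerRight hX f'
    (η_ U (P ⊗ X) ≫ U ◁ (p ▷ X ≫ (λ_ X).hom)) (by
      have h : η_ U (P ⊗ X) ≫ f' ▷ (P ⊗ X) =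
          η_ (ᘁ(Q ⊗ X) : C) (Q ⊗ X) ≫ (ᘁ(Q ⊗ X) : C) ◁ f ▷ X :=
        coevaluation_comp_leftAdjointMate (f ▷ X)
      rw [Category.assoc, whisker_exchange, reassoc_of% h, ← whiskerLeft_comp,
        ← comp_whiskerRight_assoc, hfp]
      simp)
  have := (H (X ⊗ 𝟙_ C)).1
  have : Mono (k ▷ 𝟙_ C) := by
    rw [whiskerRight_id]
    infer_instance
  exact ⟨@HasLeftDual.mk _ _ _ X (kernel f') (exactPairingOfEpiMono p k ev co hev hco)⟩

theorem _root_.TensorProjective.isRigid {X : C} (hX : TensorProjective X) : IsRigid X := by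
  refine ⟨hX.nonempty_hasLeftDual, ?_⟩
  obtain ⟨⟨Y, _⟩⟩ := hX.op.nonempty_hasLeftDual
  let := ExactPairing.unop Y (Opposite.op X)
  exact ⟨⟨Y.unop⟩⟩

theorem isRigid_iff_tensorProjective {X : C} : IsRigid X ↔ TensorProjective X :=
  ⟨IsRigid.tensorProjective, TensorProjective.isRigid⟩

theorem tensorProjective_two_out_of_three {S : ShortComplex C} (hS : S.ShortExact)
    (h : (TensorProjective S.X₁ ∧ TensorProjective S.X₂) ∨
      (TensorProjective S.X₁ ∧ TensorProjective S.X₃) ∨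
      (TensorProjective S.X₂ ∧ TensorProjective S.X₃)) :
    TensorProjective S.X₁ ∧ TensorProjective S.X₂ ∧ TensorProjective S.X₃ := by
  suffices key : ∀ P : C, Projective P →
      (Projective (P ⊗ S.X₁) ∧ Projective (S.X₁ ⊗ P)) ∧
      (Projective (P ⊗ S.X₂) ∧ Projective (S.X₂ ⊗ P)) ∧
      (Projective (P ⊗ S.X₃) ∧ Projective (S.X₃ ⊗ P)) from
    ⟨fun P hP => (key P hP).1, fun P hP => (key P hP).2.1, fun P hP => (key P hP).2.2⟩
  intro P hP
  have hP' := isRigid_of_projective P hP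
  have := hP'.preservesLimits_tensorLeft
  have := hP'.preservesColimits_tensorLeft
  have := hP'.preservesLimits_tensorRight
  have := hP'.preservesColimits_tensorRight
  have hl : _ → Projective (P ⊗ S.X₁) ∧ Projective (P ⊗ S.X₂) ∧ Projective (P ⊗ S.X₃) :=
    projective_two_out_of_three (hS.map_of_exact (tensorLeft P))
  have hr : _ → Projective (S.X₁ ⊗ P) ∧ Projective (S.X₂ ⊗ P) ∧ Projective (S.X₃ ⊗ P) :=
    projective_two_out_of_three (hS.map_of_exact (tensorRight P))
  obtain ⟨h, h'⟩ | ⟨h, h'⟩ | ⟨h, h'⟩ := h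
  · have hl := hl (.inl ⟨(h P hP).1, (h' P hP).1⟩)
    have hr := hr (.inl ⟨(h P hP).2, (h' P hP).2⟩)
    tauto
  · have hl := hl (.inr (.inl ⟨(h P hP).1, (h' P hP).1⟩))
    have hr := hr (.inr (.inl ⟨(h P hP).2, (h' P hP).2⟩))
    tauto
  · have hl := hl (.inr (.inr ⟨(h P hP).1, (h' P hP).1⟩))
    have hr := hr (.inr (.inr ⟨(h P hP).2, (h' P hP).2⟩))
    tauto

end RigidFrobenius

/-- Let `C` be an abelian monoidal category whose tensor product is additive in each
variable.  Assume `C` has enough projectives and enough injectives, that projective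
objects are injective and vice versa, and that every projective object is rigid.
If `0 → L → M → N → 0` is a short exact sequence in which two of the three objects are
rigid, then the third is rigid as well (so all three are rigid). -/
theorem rigid_two_out_of_three
    {C : Type*} [Category C] [Abelian C] [MonoidalCategory C] [MonoidalPreadditive C]
    [EnoughProjectives C] [EnoughInjectives C]
    (hPI : ∀ P : C, Projective P → Injective P)
    (hIP : ∀ I : C, Injective I → Projective I)
    (hPR : ∀ P : C, Projective P → IsRigid P)
    (S : ShortComplex C) (hS : S.ShortExact)
    (h2 : (IsRigid S.X₁ ∧ IsRigid S.X₂) ∨ (IsRigid S.X₁ ∧ IsRigid S.X₃) ∨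
      (IsRigid S.X₂ ∧ IsRigid S.X₃)) :
    IsRigid S.X₁ ∧ IsRigid S.X₂ ∧ IsRigid S.X₃ := by
  have : RigidFrobenius C := ⟨inferInstance, inferInstance, hPI, hIP, hPR⟩
  simp only [RigidFrobenius.isRigid_iff_tensorProjective] at h2 ⊢
  exact RigidFrobenius.tensorProjective_two_out_of_three hS h2
end

section
/- Let p ≥ 2 be an integer and let 1 ≤ s, t ≤ p. Define Q_i = U_{2p−1−i} + U_{i−1} ∈ ℤ[X] for 1 ≤ i ≤ p−1 and Q_p = U_{p−1}. Then in ℤ[X] one has the identity U_{s−1}·U_{t−1} = Σ U_{i−1} + Σ Q_i, where the first sum runs over all integers i with |s−t|+1 ≤ i ≤ min(s+t−1, 2p−1−s−t) and i ≡ s+t+1 (mod 2), and the second sum runs over all integers i with 2p+1−s−t ≤ i ≤ p and i ≡ s+t+1 (mod 2); sums over an empty index set are zero. -/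
open Polynomial

/-- The rescaled Chebyshev polynomials of the second kind:
`U₀ = 1`, `U₁ = X`, `U_{n+2} = X·U_{n+1} − U_n`. -/
noncomputable def U : ℕ → Polynomial ℤ
  | 0 => 1
  | 1 => X
  | (n + 2) => X * U (n + 1) - U n

/-- For `1 ≤ i ≤ p−1` set `Q i = U (2p−1−i) + U (i−1)`, and `Q p = U (p−1)`.
(These are the classes of the projective `W_p`-modules `P_i^+`.) -/
noncomputable def Q (p i : ℕ) : Polynomial ℤ :=
  if i = p then U (p - 1) else U (2 * p - 1 - i) + U (i - 1)

theorem U_succ_mul_U_succ (m n : ℕ) : U (m + 1) * U (n + 1) = U m * U n + U (m + n + 2) := by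
  induction n using Nat.twoStepInduction with
  | zero => simp only [U]; ring
  | one =>
    have hm : U (m + 1 + 2) = X * U (m + 2) - U (m + 1) := rfl
    rw [hm]
    simp only [U]
    ring
  | more n ih₀ ih₁ =>
    have hn : U (n + 2 + 1) = X * U (n + 1 + 1) - U (n + 1) := rfl
    have hn' : U (n + 2) = X * U (n + 1) - U n := rfl
    have hmn : U (m + (n + 2) + 2) = X * U (m + (n + 1) + 2) - U (m + n + 2) := rfl
    rw [hn', hn, hmn]
    linear_combination X * ih₁ - ih₀

/-- The Clebsch–Gordan rule. -/
theorem U_add_mul_U (d n : ℕ) : U (d + n) * U n = ∑ k ∈ Finset.range (n + 1), U (d + 2 * k) := by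
  induction n with
  | zero => simp [U]
  | succ n ih =>
    rw [Finset.sum_range_succ, ← ih, ← add_assoc, U_succ_mul_U_succ]
    congr 2
    ring

theorem U_mul_U_eq_sum_Icc {s t : ℕ} (hs : 1 ≤ s) (ht : 1 ≤ t) :
    U (s - 1) * U (t - 1) =
      ∑ i ∈ (Finset.Icc (Nat.dist s t + 1) (s + t - 1)).filter
        (fun i => i % 2 = (s + t + 1) % 2), U (i - 1) := by
  wlog hst : t ≤ s generalizing s t
  · rw [mul_comm, this ht hs (by omega), Nat.dist_comm, add_comm t s]
  obtain ⟨d, rfl⟩ := Nat.exists_eq_add_of_le' hst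
  obtain ⟨n, rfl⟩ := Nat.exists_eq_add_of_le' ht
  rw [Nat.dist_eq_sub_of_le_right hst, ← add_assoc, Nat.add_sub_cancel, Nat.add_sub_cancel,
    U_add_mul_U]
  refine Finset.sum_nbij' (fun k => d + 2 * k + 1) (fun i => (i - 1 - d) / 2) ?_ ?_ ?_ ?_ ?_
  all_goals
    simp only [Finset.mem_range, Finset.mem_filter, Finset.mem_Icc]
    intro a ha
  any_goals omega
  rfl

theorem sum_Q_eq {p N : ℕ} (hN : N ≤ 2 * p) :
    ∑ i ∈ (Finset.Icc (2 * p + 1 - N) p).filter (fun i => i % 2 = (N + 1) % 2), Q p i =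
      ∑ i ∈ (Finset.Icc (2 * p + 1 - N) (N - 1)).filter
        (fun i => i % 2 = (N + 1) % 2), U (i - 1) := by
  have hQ : ∀ i, Q p i = U (i - 1) + if i ≠ p then U (2 * p - 1 - i) else 0 := by
    intro i
    by_cases h : i = p
    · simp [Q, h]
    · simp [Q, h, add_comm]
  simp_rw [hQ]
  rw [Finset.sum_add_distrib, ← Finset.sum_filter,
    ← Finset.sum_filter_add_sum_filter_not (Finset.filter _ (Finset.Icc _ (N - 1))) (· ≤ p)]
  congr 1
  · refine Finset.sum_congr ?_ fun _ _ => rfl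
    ext i
    simp only [Finset.mem_filter, Finset.mem_Icc]
    omega
  · refine Finset.sum_nbij' (fun i => 2 * p - i) (fun i => 2 * p - i) ?_ ?_ ?_ ?_ ?_
    all_goals
      simp only [Finset.mem_filter, Finset.mem_Icc]
      intro a ha
    any_goals omega
    congr 1
    omega

/-- The fusion rule `X_s^μ ⊗ X_t^ν = ⊕ X_i^{μν} ⊕ ⊕ P_i^{μν}` of the triplet algebra
`W_p`, expressed as a polynomial identity: for `1 ≤ s, t ≤ p`,
`U_{s−1}·U_{t−1} = Σ U_{i−1} + Σ Q_i`, where the first sum runs over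
`|s−t|+1 ≤ i ≤ min(s+t−1, 2p−1−s−t)` with `i ≡ s+t+1 (mod 2)`, and the second sum runs
over `2p+1−s−t ≤ i ≤ p` with `i ≡ s+t+1 (mod 2)`. -/
theorem fusion_polynomial_identity (p s t : ℕ) (hp : 2 ≤ p)
    (hs1 : 1 ≤ s) (hsp : s ≤ p) (ht1 : 1 ≤ t) (htp : t ≤ p) :
    U (s - 1) * U (t - 1) =
      (∑ i ∈ (Finset.Icc (Nat.dist s t + 1) (min (s + t - 1) (2 * p - 1 - s - t))).filter
          (fun i => i % 2 = (s + t + 1) % 2), U (i - 1)) +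
      (∑ i ∈ (Finset.Icc (2 * p + 1 - s - t) p).filter
          (fun i => i % 2 = (s + t + 1) % 2), Q p i) := by
  have hd : Nat.dist s t = s - t + (t - s) := rfl
  rw [U_mul_U_eq_sum_Icc hs1 ht1, Nat.sub_sub (2 * p + 1), sum_Q_eq (by omega),
    ← Finset.sum_union]
  · refine Finset.sum_congr ?_ fun _ _ => rfl
    ext i
    simp only [Finset.mem_union, Finset.mem_filter, Finset.mem_Icc]
    omega
  · rw [Finset.disjoint_left]
    intro i
    simp only [Finset.mem_filter, Finset.mem_Icc]
    omega
end

section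
/- Let p ≥ 2 be an integer. For every 1 ≤ i ≤ p−1, the polynomial U_{2p−1−i}(X) + U_{i−1}(X) − 2·U_{i−1}(X) − 2·Y·U_{p−i−1}(X) = U_{2p−1−i}(X) − U_{i−1}(X) − 2Y·U_{p−i−1}(X) lies in the ideal J of ℤ[X,Y]; equivalently, in the quotient ring ℤ[X,Y]/J the class of U_{2p−1−i}(X) + U_{i−1}(X) equals 2·[U_{i−1}(X)] + 2·[Y·U_{p−i−1}(X)]. -/
open Polynomial

/-- `U n` viewed as an element of `ℤ[X,Y]`, evaluated at the variable `X`. -/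
noncomputable def UX (n : ℕ) : MvPolynomial (Fin 2) ℤ :=
  Polynomial.aeval (MvPolynomial.X 0) (U n)

/-- The variable `Y` of `ℤ[X,Y]`. -/
noncomputable def Yv : MvPolynomial (Fin 2) ℤ := MvPolynomial.X 1

/-- The ideal `J = ⟨Y² − 1, U_p(X) − U_{p−2}(X) − 2Y⟩` of `ℤ[X,Y]`. -/
noncomputable def Jmod (p : ℕ) : Ideal (MvPolynomial (Fin 2) ℤ) :=
  Ideal.span {Yv ^ 2 - 1, UX p - UX (p - 2) - 2 * Yv}

theorem U_add_two (n : ℕ) : U (n + 2) = X * U (n + 1) - U n := by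
  rw [U]

/-- The addition formula for the rescaled Chebyshev polynomials. -/
theorem U_add_add_two (k m : ℕ) : U (k + m + 2) = U (k + 1) * U (m + 1) - U k * U m := by
  induction m generalizing k with
  | zero =>
    simp only [U]
    ring
  | succ m ih =>
    rw [show k + (m + 1) + 2 = k + 1 + m + 2 by omega, ih (k + 1)]
    linear_combination U (m + 1) * U_add_two k - U (k + 1) * U_add_two m

/-- The Casoratian of two shifts of the sequence `U` is independent of the base point. -/
theorem U_casoratian (m b : ℕ) :
    U (m + b + 1) * U (m + 1) - U (m + b + 2) * U m = U b := by
  induction m with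
  | zero =>
    simp only [zero_add, U]
    ring
  | succ m ih =>
    have h := U_add_two (m + b + 1)
    rw [show m + 1 + b = m + b + 1 by omega]
    linear_combination ih + U (m + b + 2) * U_add_two m - U (m + 1) * h

theorem U_sub_mul (m b : ℕ) :
    (U (m + b + 2) - U (m + b)) * U m = U (2 * m + b + 2) - U b := by
  cases m with
  | zero => simp [U]
  | succ m =>
    have h := U_add_add_two (m + b + 2) m
    rw [show 2 * (m + 1) + b + 2 = m + b + 2 + m + 2 by omega,
      show m + 1 + b = m + b + 1 by omega]
    linear_combination -h - U_casoratian m b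

theorem UX_sub_mul (m b : ℕ) :
    (UX (m + b + 2) - UX (m + b)) * UX m = UX (2 * m + b + 2) - UX b := by
  simp only [UX, ← map_sub, ← map_mul, U_sub_mul]

theorem UX_sub_sub_mem_Jmod (m b : ℕ) :
    UX (2 * m + b + 2) - UX b - 2 * Yv * UX m ∈ Jmod (m + b + 2) := by
  rw [← UX_sub_mul, ← sub_mul]
  exact Ideal.mul_mem_right _ _ (Ideal.subset_span (by simp))

/-- For `p ≥ 2` and `1 ≤ i ≤ p−1`, the polynomial
`U_{2p−1−i}(X) − U_{i−1}(X) − 2Y·U_{p−i−1}(X)` lies in the ideal `J`; equivalently, in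
`ℤ[X,Y]/J` the class of `U_{2p−1−i}(X) + U_{i−1}(X)` equals
`2·[U_{i−1}(X)] + 2·[Y·U_{p−i−1}(X)]`.  (This expresses the Jordan–Hölder factors of the
projective `W_p`-module `P_i^+` in the Grothendieck ring `K(W_p) ≅ ℤ[X,Y]/J`.) -/
theorem projective_class_in_grothendieck_ring (p i : ℕ) (hp : 2 ≤ p)
    (hi1 : 1 ≤ i) (hip : i ≤ p - 1) :
    (UX (2 * p - 1 - i) - UX (i - 1) - 2 * Yv * UX (p - i - 1) ∈ Jmod p) ∧
    Ideal.Quotient.mk (Jmod p) (UX (2 * p - 1 - i) + UX (i - 1)) =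
      2 * Ideal.Quotient.mk (Jmod p) (UX (i - 1)) +
      2 * Ideal.Quotient.mk (Jmod p) (Yv * UX (p - i - 1)) := by
  have hmem : UX (2 * p - 1 - i) - UX (i - 1) - 2 * Yv * UX (p - i - 1) ∈ Jmod p := by
    convert UX_sub_sub_mem_Jmod (p - i - 1) (i - 1) using 4 <;> omega
  refine ⟨hmem, ?_⟩
  have h := Ideal.Quotient.eq_zero_iff_mem.mpr hmem
  simp only [map_sub, map_add, map_mul, map_ofNat] at h ⊢
  linear_combination h
end

section
/- Let p ≥ 2 be an integer and let 2 ≤ s ≤ p. The 2×2 matrix over ℚ with rows (h_{1,2} + h_{2,s}, h_{2,s}/p) and (1, h_{1,2} + h_{2,s} + 1 − 1/p) has characteristic polynomial (λ − h_{2,s−1})·(λ − h_{2,s+1}); in particular its eigenvalues are h_{2,s−1} and h_{2,s+1} (for s = p note that h_{2,p+1} = 0 = h_{1,1}). -/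
open Polynomial

/-- The conformal weights `h_{r,s} = ((rp − s)² − (p−1)²)/(4p)` of the triplet algebra
`W_p`. -/
def hw (p : ℕ) (r s : ℚ) : ℚ :=
  ((r * (p : ℚ) - s) ^ 2 - ((p : ℚ) - 1) ^ 2) / (4 * (p : ℚ))

/-- For `p ≥ 2` and `2 ≤ s ≤ p`, the matrix
`[[h_{1,2} + h_{2,s}, h_{2,s}/p], [1, h_{1,2} + h_{2,s} + 1 − 1/p]]` representing `L₀` on
`A₀(X₂⁺ ⊗̇ X_s⁻)` has characteristic polynomial `(λ − h_{2,s−1})(λ − h_{2,s+1})`; its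
eigenvalues are `h_{2,s−1}` and `h_{2,s+1}` (for `s = p` note that
`h_{2,p+1} = 0 = h_{1,1}`). -/
theorem L0_matrix_A0_X2p_Xsm_charpoly (p s : ℕ) (hp : 2 ≤ p) (hs2 : 2 ≤ s)
    (hsp : s ≤ p) :
    let M : Matrix (Fin 2) (Fin 2) ℚ :=
      !![hw p 1 2 + hw p 2 (s : ℚ), hw p 2 (s : ℚ) / (p : ℚ);
         1, hw p 1 2 + hw p 2 (s : ℚ) + 1 - 1 / (p : ℚ)]
    M.charpoly = (X - C (hw p 2 ((s : ℚ) - 1))) * (X - C (hw p 2 ((s : ℚ) + 1))) ∧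
    (∀ lam : ℚ, M.charpoly.IsRoot lam ↔
      lam = hw p 2 ((s : ℚ) - 1) ∨ lam = hw p 2 ((s : ℚ) + 1)) ∧
    hw p 2 ((p : ℚ) + 1) = 0 ∧ hw p 1 1 = 0 := by
  intro M
  have hp0 : (p : ℚ) ≠ 0 := by
    have : p ≠ 0 := by omega
    exact_mod_cast this
  have htr : M.trace = hw p 2 ((s : ℚ) - 1) + hw p 2 ((s : ℚ) + 1) := by
    simp only [M, Matrix.trace_fin_two_of, hw]
    field_simp
    ring
  have hdet : M.det = hw p 2 ((s : ℚ) - 1) * hw p 2 ((s : ℚ) + 1) := by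
    simp only [M, Matrix.det_fin_two_of, hw]
    field_simp
    ring
  have hchar : M.charpoly =
      (X - C (hw p 2 ((s : ℚ) - 1))) * (X - C (hw p 2 ((s : ℚ) + 1))) := by
    rw [Matrix.charpoly_fin_two, htr, hdet, C_add, C_mul]
    ring
  refine ⟨hchar, fun lam => ?_, ?_, ?_⟩
  · simp [hchar, IsRoot.def, sub_eq_zero]
  · simp only [hw]
    ring
  · simp only [hw]
    ring
end
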